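/- arXiv:2411.08459 — 4 statements merged into one kernel-verified Lean document; each statement's English description precedes it below -/
import Mathlib

section
/- Let p, q be natural numbers, let A be a p×p complex Hermitian matrix, D a q×q complex Hermitian matrix, and B a p×q complex matrix, and let M be the (p+q)×(p+q) Hermitian block matrix [[A, B], [Bᴴ, D]]. Then M is positive semidefinite if and only if A is positive semidefinite and there exists a p×q complex matrix W with A·W = B such that D − Wᴴ·A·W is positive semidefinite. -/
open Matrix
open scoped ComplexOrder

namespace Matrix

/-- The column space of `Gᴴ * G` contains that of `Gᴴ * H`. -/
theorem exists_conjTranspose_mul_self_mul_eq {k m n : Type*} [Fintype k] [Fintype m] [Fintype n]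
    (G : Matrix k m ℂ) (H : Matrix k n ℂ) : ∃ W : Matrix m n ℂ, Gᴴ * G * W = Gᴴ * H := by
  classical
  have hrange : (Gᴴ * G).mulVecLin.range = Gᴴ.mulVecLin.range := by
    apply Submodule.eq_of_le_of_finrank_eq
    · rw [mulVecLin_mul]
      exact LinearMap.range_comp_le_range _ _
    · exact (rank_conjTranspose_mul_self G).trans (rank_conjTranspose G).symm
  have hcol : ∀ j, ∃ w : m → ℂ, (Gᴴ * G) *ᵥ w = Gᴴ *ᵥ H.col j := fun j => by
    have hmem : Gᴴ *ᵥ H.col j ∈ (Gᴴ * G).mulVecLin.range := hrange ▸ ⟨H.col j, rfl⟩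
    exact hmem
  choose w hw using hcol
  exact ⟨(of w)ᵀ, ext fun i j => congrFun (hw j) i⟩

open scoped MatrixOrder in
/-- In a positive semidefinite block matrix, the columns of the off-diagonal block lie in the
column space of the diagonal block. -/
theorem PosSemidef.exists_mul_eq_of_fromBlocks {m n : Type*} [Fintype m] [Fintype n]
    {A : Matrix m m ℂ} {B : Matrix m n ℂ} {C : Matrix n m ℂ} {D : Matrix n n ℂ}
    (hM : (fromBlocks A B C D).PosSemidef) : ∃ W : Matrix m n ℂ, A * W = B := by
  classical
  obtain ⟨G, hG⟩ := CStarAlgebra.nonneg_iff_eq_star_mul_self.mp hM.nonneg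
  rw [star_eq_conjTranspose, ← fromCols_toCols G, conjTranspose_fromCols_eq_fromRows_conjTranspose,
    fromRows_mul_fromCols, fromBlocks_inj] at hG
  rw [hG.1, hG.2.1]
  exact exists_conjTranspose_mul_self_mul_eq _ _

end Matrix

/-- Generalized Schur complement criterion for positive semidefiniteness of a
Hermitian block matrix `[[A, B], [Bᴴ, D]]`. -/
theorem schur_complement_posSemidef_iff (p q : ℕ)
    (A : Matrix (Fin p) (Fin p) ℂ) (D : Matrix (Fin q) (Fin q) ℂ)
    (B : Matrix (Fin p) (Fin q) ℂ)
    (hA : A.IsHermitian) (hD : D.IsHermitian) :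
    (Matrix.fromBlocks A B Bᴴ D).PosSemidef ↔
      A.PosSemidef ∧
        ∃ W : Matrix (Fin p) (Fin q) ℂ, A * W = B ∧ (D - Wᴴ * A * W).PosSemidef := by
  constructor
  · intro hM
    obtain ⟨W, rfl⟩ := hM.exists_mul_eq_of_fromBlocks
    refine ⟨hM.submatrix Sum.inl, W, rfl, ?_⟩
    convert hM.conjTranspose_mul_mul_same (fromRows (-W) 1) using 1
    rw [conjTranspose_fromRows_eq_fromCols_conjTranspose, fromCols_mul_fromBlocks,
      fromCols_mul_fromRows]
    simp [conjTranspose_mul, hA.eq, Matrix.mul_assoc, sub_eq_add_neg, add_comm]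
  · rintro ⟨hA', W, rfl, hS⟩
    have hsum := (hA'.conjTranspose_mul_mul_same
      (fromCols (1 : Matrix (Fin p) (Fin p) ℂ) W)).add
      (hS.conjTranspose_mul_mul_same (fromCols (0 : Matrix (Fin q) (Fin p) ℂ) 1))
    rw [conjTranspose_fromCols_eq_fromRows_conjTranspose, fromRows_mul, fromRows_mul_fromCols,
      conjTranspose_fromCols_eq_fromRows_conjTranspose, fromRows_mul, fromRows_mul_fromCols,
      fromBlocks_add] at hsum
    simpa [conjTranspose_mul, hA.eq] using hsum
end

section
/- Let n ≥ 1 and let T be an n×n complex positive semidefinite Toeplitz matrix, i.e., T_{ij} depends only on the difference i − j, and let r = rank(T). Then there exist r pairwise distinct frequencies f_1, …, f_r ∈ [0,1) and positive real numbers d_1, …, d_r such that T = ∑_{j=1}^{r} d_j · a(f_j) · a(f_j)ᴴ. -/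
open Matrix
open scoped ComplexOrder

/-- The sinusoid atom `a(f) ∈ ℂⁿ` with entries `a(f)_k = exp(-2πi k f)`. -/
noncomputable def sinusoidAtom (n : ℕ) (f : ℝ) : Fin n → ℂ :=
  fun k => Complex.exp (-(2 * Real.pi * Complex.I) * (k : ℕ) * (f : ℂ))

open Module Module.End in
/-- Every vector is a finite sum of eigenvectors of a given isometry, for distinct eigenvalues. -/
lemma LinearIsometry.exists_finsupp_eigenvectors {E : Type*} [NormedAddCommGroup E]
    [InnerProductSpace ℂ E] [FiniteDimensional ℂ E] (U : E →ₗᵢ[ℂ] E) (x : E) :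
    ∃ u : ℂ →₀ E, (∀ μ, U (u μ) = μ • u μ) ∧ ∑ μ ∈ u.support, u μ = x := by
  have hss : IsSemisimple U.toLinearMap := by
    refine isSemisimple_iff.mpr fun p hp => ⟨pᗮ, ?_, p.isCompl_orthogonal⟩
    have hmap : p.map U.toLinearMap = p := by
      refine Submodule.eq_of_le_of_finrank_eq (Submodule.map_le_iff_le_comap.mpr hp) ?_
      rw [← LinearMap.range_domRestrict]
      exact LinearMap.finrank_range_of_inj (U.injective.comp Subtype.val_injective)
    intro y hy z hz
    rw [← hmap] at hz
    obtain ⟨w, hw, rfl⟩ := hz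
    exact (U.inner_map_map w y).trans (hy w hw)
  have htop : x ∈ ⨆ μ : ℂ, eigenspace U.toLinearMap μ := by
    rw [hss.iSup_eigenspace_eq_top]; trivial
  obtain ⟨u, hu, hx⟩ := (Submodule.mem_iSup_iff_exists_finsupp _ _).mp htop
  exact ⟨u, fun μ => mem_eigenspace_iff.mp (hu μ), hx⟩

/-- Two finite families with the same Gram matrix are related by an isometry of the whole space. -/
lemma exists_linearIsometry_of_gram_eq {ι E : Type*} [Fintype ι] [NormedAddCommGroup E]
    [InnerProductSpace ℂ E] [FiniteDimensional ℂ E] {v w : ι → E}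
    (h : gram ℂ v = gram ℂ w) : ∃ U : E →ₗᵢ[ℂ] E, ∀ i, U (v i) = w i := by
  classical
  have hnorm (c : ι → ℂ) :
      ‖Fintype.linearCombination ℂ v c‖ = ‖Fintype.linearCombination ℂ w c‖ := by
    have key : inner ℂ (Fintype.linearCombination ℂ v c) (Fintype.linearCombination ℂ v c) =
        inner ℂ (Fintype.linearCombination ℂ w c) (Fintype.linearCombination ℂ w c) := by
      simp only [Fintype.linearCombination_apply, sum_inner, inner_sum, inner_smul_left,
        inner_smul_right]
      simp only [← gram_apply (𝕜 := ℂ), h]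
    rw [@norm_eq_sqrt_re_inner ℂ, @norm_eq_sqrt_re_inner ℂ, key]
  obtain ⟨g, hg⟩ := (Fintype.linearCombination ℂ v).rangeRestrict.exists_rightInverse_of_surjective
    (LinearMap.range_rangeRestrict _)
  have hg' (y : LinearMap.range (Fintype.linearCombination ℂ v)) :
      Fintype.linearCombination ℂ v (g y) = y := congr_arg Subtype.val (LinearMap.congr_fun hg y)
  let L : LinearMap.range (Fintype.linearCombination ℂ v) →ₗᵢ[ℂ] E :=
    ⟨Fintype.linearCombination ℂ w ∘ₗ g, fun y => by
      rw [LinearMap.comp_apply, ← hnorm, hg', Submodule.coe_norm]⟩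
  refine ⟨L.extend, fun i => ?_⟩
  have hv : Fintype.linearCombination ℂ v (Pi.single i 1) = v i := by simp
  have hw : Fintype.linearCombination ℂ w (Pi.single i 1) = w i := by simp
  have hL := L.extend_apply ⟨v i, Pi.single i 1, hv⟩
  refine hL.trans ?_
  change Fintype.linearCombination ℂ w (g _) = w i
  rw [← sub_eq_zero, ← norm_eq_zero, ← hw, ← map_sub, ← hnorm, map_sub, hg', hv, sub_self,
    norm_zero]

/-- An eigenvalue of an isometry has norm one. -/
lemma LinearIsometry.norm_eq_one_of_apply_eq_smul {E : Type*} [NormedAddCommGroup E]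
    [InnerProductSpace ℂ E] (U : E →ₗᵢ[ℂ] E) {x : E} (hx : x ≠ 0) {μ : ℂ} (h : U x = μ • x) :
    ‖μ‖ = 1 := by
  have := U.norm_map x
  rw [h, norm_smul] at this
  exact mul_right_cancel₀ (norm_ne_zero_iff.mpr hx) (this.trans (one_mul _).symm)

/-- The distinct eigenvalues of an isometry which occur in a vector diagonalise the Gram matrix of
its orbit. -/
lemma LinearIsometry.inner_pow_apply_eq_sum {E : Type*} [NormedAddCommGroup E]
    [InnerProductSpace ℂ E] (U : E →ₗᵢ[ℂ] E) {u : ℂ →₀ E} (hu : ∀ μ, U (u μ) = μ • u μ)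
    (i j : ℕ) :
    inner ℂ ((U ^ i) (∑ μ ∈ u.support, u μ)) ((U ^ j) (∑ μ ∈ u.support, u μ)) =
      ∑ μ ∈ u.support, ((‖u μ‖ ^ 2 : ℝ) : ℂ) * (star μ ^ i * μ ^ j) := by
  have hpow (k : ℕ) (μ : ℂ) : (U ^ k) (u μ) = μ ^ k • u μ := by
    induction k with
    | zero => simp
    | succ k ih =>
      rw [pow_succ', LinearIsometry.coe_mul, Function.comp_apply, ih, map_smul, hu, smul_smul,
        pow_succ]
  have horth {μ ν : ℂ} (h : μ ≠ ν) : inner ℂ (u μ) (u ν) = 0 := by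
    rcases eq_or_ne (u μ) 0 with h0 | h0
    · simp [h0]
    have hμ := U.norm_eq_one_of_apply_eq_smul h0 (hu μ)
    have hin := U.inner_map_map (u μ) (u ν)
    rw [hu, hu, inner_smul_left, inner_smul_right] at hin
    have hμ' : μ * (starRingEnd ℂ) μ = 1 := by simp [Complex.mul_conj', hμ]
    have : (μ - ν) * inner ℂ (u μ) (u ν) = 0 := by
      linear_combination (ν * inner ℂ (u μ) (u ν)) * hμ' - μ * hin
    exact (mul_eq_zero.mp this).resolve_left (sub_ne_zero.mpr h)
  simp only [map_sum, hpow, sum_inner, inner_sum, inner_smul_left, inner_smul_right]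
  refine Finset.sum_congr rfl fun μ hμ => ?_
  rw [Finset.sum_eq_single_of_mem μ hμ fun ν _ hν => by simp [horth hν],
    inner_self_eq_norm_sq_to_K]
  simp
  ring

/-- Every point of the unit circle is `exp (2πif)` for some `f ∈ [0,1)`. -/
lemma Complex.exists_mem_Ico_exp_eq {μ : ℂ} (h : ‖μ‖ = 1) :
    ∃ f ∈ Set.Ico (0 : ℝ) 1, Complex.exp (2 * Real.pi * Complex.I * f) = μ := by
  refine ⟨Int.fract (μ.arg / (2 * Real.pi)), ⟨Int.fract_nonneg _, Int.fract_lt_one _⟩, ?_⟩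
  have hpi : (Real.pi : ℂ) ≠ 0 := by exact_mod_cast Real.pi_ne_zero
  have : (2 * Real.pi * Complex.I * (Int.fract (μ.arg / (2 * Real.pi)) : ℝ) : ℂ) =
      μ.arg * Complex.I - (⌊μ.arg / (2 * Real.pi)⌋ : ℤ) * (2 * Real.pi * Complex.I) := by
    rw [Int.fract]; push_cast; field_simp
  rw [this, Complex.exp_periodic.sub_int_mul_eq]
  simpa [h] using Complex.norm_mul_exp_arg_mul_I μ

open scoped MatrixOrder Matrix.Norms.L2Operator in
/-- A positive semidefinite matrix is the Gram matrix of vectors in a space whose dimension is the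
rank of the matrix. -/
lemma Matrix.PosSemidef.exists_gram_eq {n : ℕ} {T : Matrix (Fin n) (Fin n) ℂ}
    (hT : T.PosSemidef) :
    ∃ (W : Submodule ℂ (EuclideanSpace ℂ (Fin n))) (v : Fin n → W),
      Module.finrank ℂ W = T.rank ∧ T = gram ℂ v := by
  obtain ⟨B, rfl⟩ := CStarAlgebra.nonneg_iff_eq_star_mul_self.mp hT.nonneg
  let e := (WithLp.linearEquiv 2 ℂ (Fin n → ℂ)).symm
  refine ⟨(Submodule.span ℂ (Set.range B.col)).map e.toLinearMap,
    fun i => ⟨e (B.col i), Submodule.mem_map_of_mem (Submodule.subset_span ⟨i, rfl⟩)⟩, ?_, ?_⟩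
  · rw [LinearEquiv.finrank_map_eq, star_eq_conjTranspose, rank_conjTranspose_mul_self,
      rank_eq_finrank_span_cols]
  · ext i j
    simp [gram_apply, e, Matrix.mul_apply, PiLp.inner_apply, mul_comm]

/-- The entries of a sum of rank-one matrices of sinusoid atoms. -/
lemma sum_smul_vecMulVec_sinusoidAtom_apply {r n : ℕ} (d f : Fin r → ℝ) (i j : Fin n) :
    (∑ k, (d k : ℂ) • vecMulVec (sinusoidAtom n (f k)) (star (sinusoidAtom n (f k)))) i j =
      ∑ k, (d k : ℂ) * (star (Complex.exp (2 * Real.pi * Complex.I * f k)) ^ (i : ℕ) *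
        Complex.exp (2 * Real.pi * Complex.I * f k) ^ (j : ℕ)) := by
  rw [Matrix.sum_apply]
  refine Finset.sum_congr rfl fun k _ => ?_
  simp only [Matrix.smul_apply, vecMulVec_apply, sinusoidAtom, Pi.star_apply, smul_eq_mul,
    Complex.star_def, ← Complex.exp_conj, ← Complex.exp_nat_mul, map_mul, map_neg,
    Complex.conj_ofReal, Complex.conj_I, map_natCast, map_ofNat]
  congr 3 <;> ring

/-- Vandermonde decomposition of a positive semidefinite Toeplitz matrix. -/
theorem vandermonde_decomposition (n : ℕ) (hn : 1 ≤ n)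
    (T : Matrix (Fin n) (Fin n) ℂ) (hT : T.PosSemidef)
    (hToep : ∀ i j k l : Fin n, (i : ℤ) - (j : ℤ) = (k : ℤ) - (l : ℤ) → T i j = T k l)
    (r : ℕ) (hr : T.rank = r) :
    ∃ (f : Fin r → ℝ) (d : Fin r → ℝ),
      Function.Injective f ∧
      (∀ j, f j ∈ Set.Ico (0 : ℝ) 1) ∧
      (∀ j, 0 < d j) ∧
      T = ∑ j, (d j : ℂ) • Matrix.vecMulVec (sinusoidAtom n (f j)) (star (sinusoidAtom n (f j))) := by
  subst hr
  obtain ⟨n, rfl⟩ := Nat.exists_eq_add_of_le' hn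
  obtain ⟨W, v, hW, hTv⟩ := hT.exists_gram_eq
  have hgram : gram ℂ (fun i : Fin n => v i.castSucc) = gram ℂ fun i : Fin n => v i.succ := by
    ext i j
    simp only [gram_apply]
    rw [← gram_apply (𝕜 := ℂ), ← gram_apply (𝕜 := ℂ), ← hTv]
    exact hToep _ _ _ _ (by simp)
  obtain ⟨U, hU⟩ := exists_linearIsometry_of_gram_eq hgram
  have horbit (i : Fin (n + 1)) : v i = (U ^ (i : ℕ)) (v 0) := by
    induction i using Fin.induction with
    | zero => simp
    | succ i ih =>
      rw [Fin.val_succ, pow_succ', LinearIsometry.coe_mul, Function.comp_apply, ← hU, ih,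
        Fin.val_castSucc]
  obtain ⟨u, hu, hsum⟩ := U.exists_finsupp_eigenvectors (v 0)
  have hT_apply (i j : Fin (n + 1)) : T i j =
      ∑ μ ∈ u.support, ((‖u μ‖ ^ 2 : ℝ) : ℂ) * (star μ ^ (i : ℕ) * μ ^ (j : ℕ)) := by
    rw [hTv, gram_apply, horbit i, horbit j, ← hsum, U.inner_pow_apply_eq_sum hu]
  have hne (μ : u.support) : u μ ≠ 0 := Finsupp.mem_support_iff.mp μ.2
  have hcard_le : u.support.card ≤ T.rank := by
    have hli := Module.End.eigenvectors_linearIndependent' U.toLinearMap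
      (fun μ : u.support => (μ : ℂ)) Subtype.val_injective (fun μ => u μ)
      fun μ => ⟨Module.End.mem_eigenspace_iff.mpr (hu μ), hne μ⟩
    simpa [hW] using hli.fintype_card_le_finrank
  have hrank_le : T.rank ≤ u.support.card := by
    have hmul : T = (of fun (i : Fin (n + 1)) (μ : u.support) =>
        ((‖u μ‖ ^ 2 : ℝ) : ℂ) * star (μ : ℂ) ^ (i : ℕ)) *
        of fun (μ : u.support) (j : Fin (n + 1)) => (μ : ℂ) ^ (j : ℕ) := by
      ext i j
      rw [hT_apply, Matrix.mul_apply, ← Finset.sum_coe_sort]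
      simp only [of_apply, mul_assoc]
    rw [hmul]
    exact (rank_mul_le_left _ _).trans ((rank_le_card_width _).trans_eq (Fintype.card_coe _))
  let e : Fin T.rank ≃ u.support :=
    (finCongr (hrank_le.antisymm hcard_le)).trans u.support.equivFin.symm
  choose f hf hexp using fun k => Complex.exists_mem_Ico_exp_eq
    (U.norm_eq_one_of_apply_eq_smul (hne (e k)) (hu (e k)))
  refine ⟨f, fun k => ‖u (e k)‖ ^ 2, fun k l hkl => ?_, hf,
    fun k => pow_pos (norm_pos_iff.mpr (hne (e k))) 2, ?_⟩
  · exact e.injective (Subtype.ext (by rw [← hexp k, ← hexp l, hkl]))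
  · ext i j
    rw [sum_smul_vecMulVec_sinusoidAtom_apply, hT_apply, ← Finset.sum_coe_sort, ← e.sum_comp]
    simp only [hexp]
end

section
/- Let T be an n×n complex positive semidefinite matrix and let x, w ∈ ℂⁿ satisfy T·w = x. Then T + βI is invertible for every β > 0, and the quadratic form xᴴ(T + βI)^{-1}x converges to xᴴw as β tends to 0 from the right; moreover xᴴw = wᴴTw is a nonnegative real number (it equals xᴴT†x, where T† is the Moore–Penrose pseudoinverse). -/
open Matrix Filter
open scoped ComplexOrder

section Hermitian

variable {ι : Type*} [Fintype ι] {T : Matrix ι ι ℂ}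

lemma Matrix.IsHermitian.star_mulVec_dotProduct (hT : T.IsHermitian) (u v : ι → ℂ) :
    star (T *ᵥ u) ⬝ᵥ v = star u ⬝ᵥ (T *ᵥ v) := by
  rw [star_mulVec, hT.eq, dotProduct_mulVec]

/-- If `(T + βI) y = w` with `T` positive semidefinite and `β ≥ 0`, then
`0 ≤ (Tw)ᴴy ≤ wᴴw`. -/
lemma Matrix.PosSemidef.star_mulVec_dotProduct_mem_Icc (hT : T.PosSemidef) {β : ℝ}
    (hβ : 0 ≤ β) {w y : ι → ℂ} (hy : T *ᵥ y + (β : ℂ) • y = w) :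
    star (T *ᵥ w) ⬝ᵥ y ∈ Set.Icc 0 (star w ⬝ᵥ w) := by
  have hβ' : (0 : ℂ) ≤ β := Complex.zero_le_real.mpr hβ
  have hq : 0 ≤ star y ⬝ᵥ (T *ᵥ y) := hT.dotProduct_mulVec_nonneg y
  have hleft (v : ι → ℂ) : star w ⬝ᵥ v = star (T *ᵥ y) ⬝ᵥ v + β * (star y ⬝ᵥ v) := by
    rw [← hy, star_add, star_smul, add_dotProduct, smul_dotProduct]
    simp
  rw [hT.isHermitian.star_mulVec_dotProduct]
  constructor
  · rw [hleft]
    exact add_nonneg (dotProduct_star_self_nonneg _) (mul_nonneg hβ' hq)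
  · have hsplit : star w ⬝ᵥ w = star w ⬝ᵥ (T *ᵥ y) + β * (star w ⬝ᵥ y) := by
      conv_lhs => rw [← hy, dotProduct_add, dotProduct_smul, smul_eq_mul, hy]
    rw [hsplit, hleft y, hT.isHermitian.star_mulVec_dotProduct]
    exact le_add_of_nonneg_right
      (mul_nonneg hβ' (add_nonneg hq (mul_nonneg hβ' (dotProduct_star_self_nonneg _))))

lemma Matrix.PosSemidef.isUnit_add_smul_one [DecidableEq ι] (hT : T.PosSemidef) {β : ℝ}
    (hβ : 0 < β) : IsUnit (T + (β : ℂ) • (1 : Matrix ι ι ℂ)) :=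
  (PosDef.posSemidef_add hT (PosDef.one.smul (Complex.zero_lt_real.mpr hβ))).isUnit

/-- Tikhonov regularization perturbs the quadratic form at `Tw` by at most `β ‖w‖²`. -/
lemma Matrix.PosSemidef.norm_quadForm_sub_le [DecidableEq ι] (hT : T.PosSemidef) {β : ℝ}
    (hβ : 0 < β) (w : ι → ℂ) :
    ‖star (T *ᵥ w) ⬝ᵥ ((T + (β : ℂ) • (1 : Matrix ι ι ℂ))⁻¹ *ᵥ (T *ᵥ w)) -
      star (T *ᵥ w) ⬝ᵥ w‖ ≤ β * ‖star w ⬝ᵥ w‖ := by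
  set S := T + (β : ℂ) • (1 : Matrix ι ι ℂ) with hS
  have hdet : IsUnit S.det := (isUnit_iff_isUnit_det S).mp (hT.isUnit_add_smul_one hβ)
  have hSv (v : ι → ℂ) : S *ᵥ v = T *ᵥ v + (β : ℂ) • v := by
    rw [hS, add_mulVec, smul_mulVec, one_mulVec]
  have hy : T *ᵥ (S⁻¹ *ᵥ w) + (β : ℂ) • (S⁻¹ *ᵥ w) = w := by
    rw [← hSv, mulVec_mulVec, mul_nonsing_inv S hdet, one_mulVec]
  have hres : S⁻¹ *ᵥ (T *ᵥ w) = w - (β : ℂ) • (S⁻¹ *ᵥ w) := by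
    rw [eq_sub_iff_add_eq, ← mulVec_smul, ← mulVec_add, ← hSv, mulVec_mulVec,
      nonsing_inv_mul S hdet, one_mulVec]
  obtain ⟨h0, h1⟩ := hT.star_mulVec_dotProduct_mem_Icc hβ.le hy
  rw [hres, dotProduct_sub, dotProduct_smul, smul_eq_mul, sub_sub_cancel_left, norm_neg,
    norm_mul, Complex.norm_real, Real.norm_of_nonneg hβ.le]
  exact mul_le_mul_of_nonneg_left (CStarAlgebra.norm_le_norm_of_nonneg_of_le h0 h1) hβ.le

end Hermitian

/-- If `T` is positive semidefinite and `x = T w` lies in the range of `T`, then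
`T + βI` is invertible for all `β > 0`, the quadratic form `xᴴ(T + βI)⁻¹x` converges
to `xᴴw` as `β → 0⁺`, and `xᴴw = wᴴTw` is a nonnegative real number. -/
theorem quadForm_tendsto_of_mem_range (n : ℕ)
    (T : Matrix (Fin n) (Fin n) ℂ) (hT : T.PosSemidef)
    (x w : Fin n → ℂ) (hw : T *ᵥ w = x) :
    (∀ β : ℝ, 0 < β → IsUnit (T + (β : ℂ) • (1 : Matrix (Fin n) (Fin n) ℂ))) ∧
    Tendsto (fun β : ℝ => star x ⬝ᵥ ((T + (β : ℂ) • (1 : Matrix (Fin n) (Fin n) ℂ))⁻¹ *ᵥ x))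
      (nhdsWithin 0 (Set.Ioi 0)) (nhds (star x ⬝ᵥ w)) ∧
    star x ⬝ᵥ w = star w ⬝ᵥ (T *ᵥ w) ∧
    0 ≤ (star x ⬝ᵥ w).re ∧ (star x ⬝ᵥ w).im = 0 := by
  subst hw
  have heq := hT.isHermitian.star_mulVec_dotProduct w w
  have hnonneg : 0 ≤ star (T *ᵥ w) ⬝ᵥ w := heq ▸ hT.dotProduct_mulVec_nonneg w
  refine ⟨fun β hβ => hT.isUnit_add_smul_one hβ, ?_, heq,
    (Complex.nonneg_iff.mp hnonneg).1, (Complex.nonneg_iff.mp hnonneg).2.symm⟩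
  rw [tendsto_iff_norm_sub_tendsto_zero]
  have hbound : Tendsto (fun β : ℝ => β * ‖star w ⬝ᵥ w‖)
      (nhdsWithin 0 (Set.Ioi 0)) (nhds 0) := by
    have hcont : Continuous (fun β : ℝ => β * ‖star w ⬝ᵥ w‖) := by fun_prop
    simpa using (hcont.tendsto 0).mono_left nhdsWithin_le_nhds
  refine squeeze_zero' (Eventually.of_forall fun _ => norm_nonneg _) ?_ hbound
  filter_upwards [self_mem_nhdsWithin] with β hβ
  exact hT.norm_quadForm_sub_le hβ w
end

section
/- Let T be an n×n complex positive semidefinite matrix and let x ∈ ℂⁿ be a vector that does not lie in the column space (range) of T. Then the real number Re(xᴴ(T + βI)^{-1}x) tends to +∞ as β tends to 0 from the right. -/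
open Matrix Filter
open scoped ComplexOrder

/-- A vector outside the column space of a Hermitian matrix pairs to `1` with some vector of
its kernel. -/
theorem exists_mulVec_eq_zero_and_dotProduct_eq_one {m : Type*} [Fintype m]
    {T : Matrix m m ℂ} (hT : T.IsHermitian) {x : m → ℂ} (hx : ¬ ∃ v, T *ᵥ v = x) :
    ∃ w, T *ᵥ w = 0 ∧ star w ⬝ᵥ x = 1 := by
  classical
  obtain ⟨f, hfx, hf⟩ := Submodule.exists_le_ker_of_notMem (p := LinearMap.range T.mulVecLin)
    (v := x) (by simpa using hx)
  obtain ⟨u, rfl⟩ := (dotProductEquiv ℂ m).surjective f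
  simp only [dotProductEquiv_apply_apply] at hfx
  have hu : u ᵥ* T = 0 := by
    refine dotProduct_eq _ _ fun v => ?_
    have h := hf (LinearMap.mem_range_self T.mulVecLin v)
    simpa [dotProduct_mulVec] using h
  refine ⟨star ((u ⬝ᵥ x)⁻¹ • u), ?_, ?_⟩
  · rw [← hT.eq, ← star_vecMul, smul_vecMul, hu, smul_zero, star_zero]
  · rw [star_star, smul_dotProduct, smul_eq_mul, inv_mul_cancel₀ hfx]

/-- The variational lower bound for the quadratic form of the inverse of a positive definite
matrix. -/
theorem Matrix.PosDef.two_mul_re_sub_le_re_inv {m : Type*} [Fintype m] [DecidableEq m]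
    {A : Matrix m m ℂ} (hA : A.PosDef) (x z : m → ℂ) :
    2 * (star z ⬝ᵥ x).re - (star z ⬝ᵥ (A *ᵥ z)).re ≤ (star x ⬝ᵥ (A⁻¹ *ᵥ x)).re := by
  have hAy : A *ᵥ (A⁻¹ *ᵥ x) = x := by
    rw [mulVec_mulVec, mul_nonsing_inv _ ((isUnit_iff_isUnit_det A).1 hA.isUnit), one_mulVec]
  set y := A⁻¹ *ᵥ x
  have hyA : star y ᵥ* A = star x := by
    simpa only [hAy, hA.isHermitian.eq] using (star_mulVec A y).symm
  have h := (Complex.le_def.1 (hA.posSemidef.dotProduct_mulVec_nonneg (y - z))).1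
  have hyx : (star y ⬝ᵥ x).re = (star x ⬝ᵥ y).re := by
    rw [← hyA, ← dotProduct_mulVec, hAy]
  have hxz : (star x ⬝ᵥ z).re = (star z ⬝ᵥ x).re := by
    rw [star_dotProduct x z]
    exact Complex.conj_re _
  rw [mulVec_sub, hAy, star_sub, sub_dotProduct, dotProduct_sub, dotProduct_sub,
    dotProduct_mulVec (star y), hyA] at h
  simp only [Complex.sub_re, Complex.zero_re] at h
  linarith

/-- If `T` is positive semidefinite and `x` does not lie in the column space of `T`, then
`Re(xᴴ(T + βI)⁻¹x)` tends to `+∞` as `β → 0⁺`. -/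
theorem quadForm_tendsto_atTop_of_not_mem_range (n : ℕ)
    (T : Matrix (Fin n) (Fin n) ℂ) (hT : T.PosSemidef)
    (x : Fin n → ℂ) (hx : ¬ ∃ v : Fin n → ℂ, T *ᵥ v = x) :
    Tendsto (fun β : ℝ =>
        (star x ⬝ᵥ ((T + (β : ℂ) • (1 : Matrix (Fin n) (Fin n) ℂ))⁻¹ *ᵥ x)).re)
      (nhdsWithin 0 (Set.Ioi 0)) atTop := by
  obtain ⟨w, hTw, hwx⟩ := exists_mulVec_eq_zero_and_dotProduct_eq_one hT.isHermitian hx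
  set W : ℝ := (star w ⬝ᵥ w).re
  have hW : 0 ≤ W := (Complex.le_def.1 (dotProduct_star_self_nonneg w)).1
  have hs : 0 < (W + 1)⁻¹ := by positivity
  refine tendsto_atTop_mono' _ ?_ (tendsto_inv_nhdsGT_zero.const_mul_atTop hs)
  filter_upwards [self_mem_nhdsWithin] with β (hβ : 0 < β)
  have hA : (T + (β : ℂ) • (1 : Matrix (Fin n) (Fin n) ℂ)).PosDef :=
    PosDef.posSemidef_add hT (PosDef.one.smul (by exact_mod_cast hβ))
  refine le_trans ?_ (hA.two_mul_re_sub_le_re_inv x ((((W + 1)⁻¹ * β⁻¹ : ℝ) : ℂ) • w))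
  set t : ℝ := (W + 1)⁻¹ * β⁻¹ with ht
  have hAw : (T + (β : ℂ) • (1 : Matrix (Fin n) (Fin n) ℂ)) *ᵥ w = (β : ℂ) • w := by
    rw [add_mulVec, hTw, zero_add, smul_mulVec, one_mulVec]
  have hlin : (star ((t : ℂ) • w) ⬝ᵥ x).re = t := by
    simp [star_smul, smul_dotProduct, hwx]
  have hquad : (star ((t : ℂ) • w) ⬝ᵥ
      ((T + (β : ℂ) • (1 : Matrix (Fin n) (Fin n) ℂ)) *ᵥ ((t : ℂ) • w))).re
      = t * (t * (β * W)) := by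
    rw [mulVec_smul, hAw]
    simp only [star_smul, smul_dotProduct, dotProduct_smul, smul_eq_mul, RCLike.star_def,
      Complex.conj_ofReal, Complex.re_ofReal_mul, W]
    ring
  have hle : t * (β * W) ≤ 1 := by
    have : t * (β * W) = W / (W + 1) := by rw [ht]; field_simp
    rw [this, div_le_one (by positivity)]
    linarith
  have ht0 : 0 ≤ t := by positivity
  rw [hlin, hquad]
  nlinarith [mul_le_mul_of_nonneg_left hle ht0]
end
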